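/- Let ε, α and β be real numbers with ε > 0, β > 0, α < β and α + β ≤ 2. Then there exist positive constants c and C (depending only on ε, α, β) such that the following holds. Let G be a finite simple graph on n ≥ 1 vertices with average degree d = 2e(G)/n > 0. Then either G has surplus at least c·n^α·d^β, or G has an induced subgraph G̃ with ñ vertices and average degree d̃ such that ñ^α·d̃^β ≥ (1−ε)·n^α·d^β and the maximum degree of G̃ is at most C·d̃. -/

import Mathlib

namespace MaxCutPaper

variable {V : Type*}

/-- The size of the cut induced by a vertex subset `S`: the number of edges of `G`
with one endpoint in `S` and the other outside `S` (counted via ordered pairs with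
first coordinate in `S`). -/
noncomputable def cutSize [Fintype V] (G : SimpleGraph V) (S : Finset V) : ℕ :=
  Nat.card {p : V × V // p.1 ∈ S ∧ p.2 ∉ S ∧ G.Adj p.1 p.2}

/-- The maximum size of a cut of `G`. -/
noncomputable def maxCut [Fintype V] (G : SimpleGraph V) : ℕ :=
  (Finset.univ : Finset V).powerset.sup (cutSize G)

/-- The number of edges of `G`. -/
noncomputable def edgeCount (G : SimpleGraph V) : ℕ := Nat.card G.edgeSet

/-- The surplus of `G`: `mc(G) - e(G)/2`. -/
noncomputable def surplus [Fintype V] (G : SimpleGraph V) : ℝ :=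
  (maxCut G : ℝ) - (edgeCount G : ℝ) / 2

/-- The degree of a vertex. -/
noncomputable def degC (G : SimpleGraph V) (v : V) : ℕ := Nat.card (G.neighborSet v)

/-- The number of copies of `K_r` in `G`, i.e. `r`-element sets of pairwise adjacent
vertices. -/
noncomputable def cliqueCount (G : SimpleGraph V) (r : ℕ) : ℕ :=
  Nat.card {s : Finset V // G.IsNClique r s}

/-- `G` contains no cycle of length `r`. -/
def CycleFree (G : SimpleGraph V) (r : ℕ) : Prop :=
  ∀ ⦃v : V⦄ (w : G.Walk v v), w.IsCycle → w.length ≠ r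

/-- `G` is `d`-degenerate (for a real `d ≥ 0`): every (induced) subgraph has a vertex of
degree at most `d`. -/
def Degenerate (G : SimpleGraph V) (d : ℝ) : Prop :=
  ∀ B : Finset V, B.Nonempty → ∃ v ∈ B, (Nat.card {u : V // u ∈ B ∧ G.Adj v u} : ℝ) ≤ d

/-- The number of edges of `G` with both endpoints in `T`. -/
noncomputable def edgesIn (G : SimpleGraph V) (T : Finset V) : ℝ :=
  (Nat.card {p : V × V // p.1 ∈ T ∧ p.2 ∈ T ∧ G.Adj p.1 p.2} : ℝ) / 2

/-- The `0`/`1` weight of a pair of vertices, as a real number. -/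
noncomputable def adjWeight (G : SimpleGraph V) (u v : V) : ℝ :=
  open Classical in if G.Adj u v then 1 else 0

/-- The number of adjacent ordered pairs in `S × T`. -/
noncomputable def pairCount (G : SimpleGraph V) (S T : Finset V) : ℝ :=
  ∑ u ∈ S, ∑ v ∈ T, adjWeight G u v

lemma adjWeight_nonneg (G : SimpleGraph V) (u v : V) : 0 ≤ adjWeight G u v := by
  unfold adjWeight; split_ifs <;> norm_num

lemma adjWeight_le_one (G : SimpleGraph V) (u v : V) : adjWeight G u v ≤ 1 := by
  unfold adjWeight; split_ifs <;> norm_num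

lemma adjWeight_self (G : SimpleGraph V) (u : V) : adjWeight G u u = 0 := by
  simp [adjWeight]

lemma adjWeight_comm (G : SimpleGraph V) (u v : V) : adjWeight G u v = adjWeight G v u := by
  classical
  unfold adjWeight
  exact if_congr (G.adj_comm u v) rfl rfl

lemma pairCount_nonneg (G : SimpleGraph V) (S T : Finset V) : 0 ≤ pairCount G S T :=
  Finset.sum_nonneg fun _ _ => Finset.sum_nonneg fun _ _ => adjWeight_nonneg G _ _

lemma pairCount_comm (G : SimpleGraph V) (S T : Finset V) :
    pairCount G S T = pairCount G T S := by
  unfold pairCount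
  rw [Finset.sum_comm]
  simp only [adjWeight_comm G]

lemma pairCount_le (G : SimpleGraph V) (S : Finset V) : pairCount G S S ≤ (S.card : ℝ) ^ 2 := by
  calc pairCount G S S ≤ ∑ _u ∈ S, ∑ _v ∈ S, (1 : ℝ) :=
        Finset.sum_le_sum fun _ _ => Finset.sum_le_sum fun _ _ => adjWeight_le_one G _ _
    _ = (S.card : ℝ) ^ 2 := by simp [sq]

lemma natCard_neighbors (G : SimpleGraph V) [Fintype V] (A : Finset V) (v : V) :
    (Nat.card {u : V // u ∈ A ∧ G.Adj v u} : ℝ) = ∑ u ∈ A, adjWeight G v u := by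
  classical
  rw [Nat.card_eq_fintype_card, Fintype.card_subtype]
  simp only [adjWeight]
  rw [Finset.sum_boole]
  congr 2
  ext; simp

lemma two_mul_edgeCount [Fintype V] (G : SimpleGraph V) :
    2 * (edgeCount G : ℝ) = pairCount G Finset.univ Finset.univ := by
  classical
  have h := G.sum_degrees_eq_twice_card_edges
  have h2 : edgeCount G = G.edgeFinset.card := by
    rw [edgeCount, Nat.card_eq_fintype_card, SimpleGraph.edgeFinset_card]
  rw [h2, pairCount]
  have h3 : (∑ v, (G.degree v : ℝ)) = 2 * (G.edgeFinset.card : ℝ) := by exact_mod_cast h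
  rw [← h3]
  refine Finset.sum_congr rfl fun v _ => ?_
  simp only [adjWeight]
  rw [Finset.sum_boole, ← SimpleGraph.card_neighborFinset_eq_degree]
  congr 2
  ext; simp

lemma two_mul_edgeCount_induce (G : SimpleGraph V) (A : Finset V) :
    2 * (edgeCount (G.induce (↑A : Set V)) : ℝ) = pairCount G A A := by
  classical
  have h := two_mul_edgeCount (V := A) (G.induce (↑A : Set V))
  have h2 : ∀ u v : A, adjWeight (G.induce (↑A : Set V)) u v = adjWeight G u v := by
    intro u v; simp [adjWeight]
  refine h.trans ?_
  unfold pairCount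
  rw [← Finset.sum_coe_sort A]
  refine Finset.sum_congr rfl fun u _ => ?_
  rw [← Finset.sum_coe_sort A]
  exact Finset.sum_congr rfl fun v _ => h2 u v

lemma cutSize_eq_pairCount [Fintype V] [DecidableEq V] (G : SimpleGraph V) (S : Finset V) :
    (cutSize G S : ℝ) = pairCount G S Sᶜ := by
  classical
  rw [cutSize, Nat.card_eq_fintype_card, Fintype.card_subtype, pairCount,
    ← Finset.sum_product' S Sᶜ (adjWeight G)]
  simp only [adjWeight]
  rw [Finset.sum_boole]
  congr 2
  ext ⟨u, v⟩
  simp [and_assoc]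

/-- The quadratic form of the adjacency matrix. -/
noncomputable def adjForm [Fintype V] (G : SimpleGraph V) (x : V → ℝ) : ℝ :=
  ∑ u, ∑ v, adjWeight G u v * (x u * x v)

lemma adjForm_update_affine [Fintype V] [DecidableEq V] (G : SimpleGraph V) (x : V → ℝ) (t : V) :
    ∃ a b : ℝ, ∀ s, adjForm G (Function.update x t s) = a + b * s := by
  have key : ∀ u v : V, ∃ a b : ℝ, ∀ s : ℝ,
      adjWeight G u v * (Function.update x t s u * Function.update x t s v) = a + b * s := by
    intro u v
    by_cases hu : u = t <;> by_cases hv : v = t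
    · subst hu; subst hv
      exact ⟨0, 0, fun s => by simp [adjWeight_self]⟩
    · subst hu
      exact ⟨0, adjWeight G u v * x v, fun s => by simp [hv]; ring⟩
    · subst hv
      exact ⟨0, adjWeight G u v * x u, fun s => by simp [hu]; ring⟩
    · exact ⟨adjWeight G u v * (x u * x v), 0, fun s => by simp [hu, hv]⟩
  choose a b h using key
  refine ⟨∑ u, ∑ v, a u v, ∑ u, ∑ v, b u v, fun s => ?_⟩
  simp only [adjForm, h, Finset.sum_add_distrib, Finset.sum_mul]

/-- Rounding the coordinates of a vector in the cube to signs without increasing the form. -/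
lemma exists_sign_adjForm_le [Fintype V] (G : SimpleGraph V) (x : V → ℝ)
    (hx : ∀ v, |x v| ≤ 1) :
    ∃ y : V → ℝ, (∀ v, y v = 1 ∨ y v = -1) ∧ adjForm G y ≤ adjForm G x := by
  classical
  have key : ∀ T : Finset V, ∃ y : V → ℝ, (∀ v ∈ T, y v = 1 ∨ y v = -1) ∧
      (∀ v ∉ T, y v = x v) ∧ adjForm G y ≤ adjForm G x := by
    intro T
    induction T using Finset.induction_on with
    | empty => exact ⟨x, by simp, by simp, le_rfl⟩
    | insert t T ht ih =>
      obtain ⟨y, h1, h2, h3⟩ := ih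
      obtain ⟨a, b, hab⟩ := adjForm_update_affine G y t
      have hy : adjForm G y = a + b * x t := by
        rw [← hab, ← h2 t ht, Function.update_eq_self]
      obtain ⟨hl, hr⟩ := abs_le.1 (hx t)
      have hs : ∃ s : ℝ, (s = 1 ∨ s = -1) ∧ b * s ≤ b * x t := by
        rcases le_total 0 b with hb | hb
        · exact ⟨-1, Or.inr rfl, mul_le_mul_of_nonneg_left hl hb⟩
        · exact ⟨1, Or.inl rfl, mul_le_mul_of_nonpos_left hr hb⟩
      obtain ⟨s, hs, hbs⟩ := hs
      refine ⟨Function.update y t s, fun v hv => ?_, fun v hv => ?_, ?_⟩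
      · by_cases hvt : v = t
        · subst hvt; simpa using hs
        · simpa [hvt] using h1 v (Finset.mem_of_mem_insert_of_ne hv hvt)
      · rw [Finset.mem_insert, not_or] at hv
        simpa [hv.1] using h2 v hv.2
      · rw [hab]; linarith
  obtain ⟨y, h1, -, h3⟩ := key Finset.univ
  exact ⟨y, fun v => h1 v (Finset.mem_univ v), h3⟩

lemma adjForm_sub_smul [Fintype V] [DecidableEq V] (G : SimpleGraph V) (S T : Finset V) (δ : ℝ) :
    adjForm G (fun v => (if v ∈ S then 1 else 0) - δ * (if v ∈ T then 1 else 0)) =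
      pairCount G S S - 2 * δ * pairCount G S T + δ ^ 2 * pairCount G T T := by
  have key : ∀ S T : Finset V, pairCount G S T = ∑ u, ∑ v,
      adjWeight G u v * ((if u ∈ S then 1 else 0) * (if v ∈ T then 1 else 0)) := by
    intro S T
    simp [pairCount, Finset.sum_ite_mem, mul_ite]
  have e : 2 * δ * pairCount G S T = δ * pairCount G S T + δ * pairCount G T S := by
    rw [pairCount_comm G T S]; ring
  rw [e]
  simp only [key, adjForm, Finset.mul_sum, ← Finset.sum_add_distrib, ← Finset.sum_sub_distrib]
  exact Finset.sum_congr rfl fun u _ => Finset.sum_congr rfl fun v _ => by ring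

lemma pairCount_add_compl [Fintype V] [DecidableEq V] (G : SimpleGraph V) (S : Finset V) :
    pairCount G Finset.univ Finset.univ =
      pairCount G S S + 2 * pairCount G S Sᶜ + pairCount G Sᶜ Sᶜ := by
  have e : 2 * pairCount G S Sᶜ = pairCount G S Sᶜ + pairCount G Sᶜ S := by
    rw [pairCount_comm G Sᶜ S]; ring
  rw [e]
  unfold pairCount
  simp only [← Finset.sum_add_sum_compl S, Finset.sum_add_distrib]
  ring

lemma neg_adjForm_le_surplus [Fintype V] (G : SimpleGraph V) (x : V → ℝ)
    (hx : ∀ v, |x v| ≤ 1) : -adjForm G x / 4 ≤ surplus G := by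
  classical
  obtain ⟨y, hy, hle⟩ := exists_sign_adjForm_le G x hx
  set S : Finset V := Finset.univ.filter fun v => y v = 1 with hS
  have hy' : y = fun v => (if v ∈ S then (1 : ℝ) else 0) - 1 * (if v ∈ Sᶜ then 1 else 0) := by
    funext v
    rcases hy v with h | h
    · simp [hS, h]
    · have : ¬ ((-1 : ℝ) = 1) := by norm_num
      simp [hS, h, this]
  have hcut : cutSize G S ≤ maxCut G :=
    Finset.le_sup (f := cutSize G) (Finset.mem_powerset.2 (Finset.subset_univ S))
  have hcut' : pairCount G S Sᶜ ≤ (maxCut G : ℝ) := by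
    rw [← cutSize_eq_pairCount]; exact_mod_cast hcut
  have h1 := two_mul_edgeCount G
  have h2 := pairCount_add_compl G S
  have h3 := adjForm_sub_smul G S Sᶜ 1
  rw [← hy'] at h3
  unfold surplus
  linarith

lemma rpow_mul_rpow_le_self {α β m E : ℝ} (hαβ : α < β) (hsum : α + β ≤ 2)
    (hm : 1 ≤ m) (hE : m ≤ E) (hE' : E ≤ m ^ 2) : m ^ (α - β) * E ^ β ≤ E := by
  have hm0 : 0 < m := by linarith
  have hE0 : 0 < E := by linarith
  have hsplit : m ^ (α - β) * E ^ β = m ^ (α - β) * E ^ (β - 1) * E := by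
    rw [mul_assoc, ← Real.rpow_add_one hE0.ne', sub_add_cancel]
  have h0 : 0 ≤ m ^ (α - β) := by positivity
  rw [hsplit]
  refine mul_le_of_le_one_left hE0.le ?_
  rcases le_total β 1 with hb | hb
  · calc m ^ (α - β) * E ^ (β - 1) ≤ m ^ (α - β) * m ^ (β - 1) :=
          mul_le_mul_of_nonneg_left (Real.rpow_le_rpow_of_nonpos hm0 hE (by linarith)) h0
      _ = m ^ (α - 1) := by rw [← Real.rpow_add hm0]; ring_nf
      _ ≤ 1 := Real.rpow_le_one_of_one_le_of_nonpos hm (by linarith)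
  · calc m ^ (α - β) * E ^ (β - 1) ≤ m ^ (α - β) * (m ^ 2) ^ (β - 1) :=
          mul_le_mul_of_nonneg_left (Real.rpow_le_rpow hE0.le hE' (by linarith)) h0
      _ = m ^ (α + β - 2) := by
          rw [← Real.rpow_natCast, ← Real.rpow_mul hm0.le, ← Real.rpow_add hm0]
          push_cast; ring_nf
      _ ≤ 1 := Real.rpow_le_one_of_one_le_of_nonpos hm (by linarith)

lemma le_mul_of_rpow_mul_le {α β u a K τ x y : ℝ} (hβ : 0 < β) (hαβ : α < β) (hu : 0 < u)
    (hK : 0 < K) (hτ : 0 < τ) (hKτ : K ^ (α - β) = τ ^ β) (hua : u * K ≤ a) (hx : 0 ≤ x)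
    (hy : 0 ≤ y) (h : u ^ (α - β) * x ^ β ≤ a ^ (α - β) * y ^ β) : x ≤ τ * y := by
  have h1 : a ^ (α - β) ≤ u ^ (α - β) * τ ^ β := by
    rw [← hKτ, ← Real.mul_rpow hu.le hK.le]
    exact Real.rpow_le_rpow_of_nonpos (by positivity) hua (by linarith)
  have h2 : u ^ (α - β) * x ^ β ≤ u ^ (α - β) * (τ * y) ^ β := by
    rw [Real.mul_rpow hτ.le hy, ← mul_assoc]
    exact h.trans (mul_le_mul_of_nonneg_right h1 (by positivity))
  exact (Real.rpow_le_rpow_iff hx (by positivity) hβ).1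
    (le_of_mul_le_mul_left h2 (by positivity))

lemma rpow_mul_div_rpow {α β m E : ℝ} (hm : 0 < m) (hE : 0 ≤ E) :
    m ^ α * (E / m) ^ β = m ^ (α - β) * E ^ β := by
  rw [Real.div_rpow hE hm.le, Real.rpow_sub hm]
  ring

/-- A set maximizing `|S| ^ (α - β) * pairCount G S S ^ β` has no isolated vertices. -/
lemma card_le_pairCount_of_maximal (G : SimpleGraph V) {α β : ℝ} (hαβ : α < β)
    {A : Finset V} (hE : 0 < pairCount G A A)
    (hmax : ∀ S ⊆ A, (S.card : ℝ) ^ (α - β) * pairCount G S S ^ β ≤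
      (A.card : ℝ) ^ (α - β) * pairCount G A A ^ β) :
    (A.card : ℝ) ≤ pairCount G A A := by
  classical
  have hdeg : ∀ v ∈ A, 1 ≤ ∑ u ∈ A, adjWeight G v u := by
    intro v hv
    by_cases hex : ∃ u ∈ A, G.Adj v u
    · obtain ⟨u, hu, huv⟩ := hex
      calc (1 : ℝ) = adjWeight G v u := by simp [adjWeight, huv]
        _ ≤ _ := Finset.single_le_sum (f := fun u => adjWeight G v u)
            (fun _ _ => adjWeight_nonneg G _ _) hu
    · exfalso
      push Not at hex
      have hz : ∀ u ∈ A, adjWeight G v u = 0 := fun u hu => by simp [adjWeight, hex u hu]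
      have herase : pairCount G (A.erase v) (A.erase v) = pairCount G A A := by
        unfold pairCount
        rw [← Finset.add_sum_erase A (fun u => ∑ w ∈ A, adjWeight G u w) hv,
          Finset.sum_eq_zero hz, zero_add]
        refine Finset.sum_congr rfl fun u hu => ?_
        rw [← Finset.add_sum_erase A (fun w => adjWeight G u w) hv, adjWeight_comm,
          hz u (Finset.mem_of_mem_erase hu), zero_add]
      have hpos : 0 < (A.erase v).card := by
        rw [Finset.card_pos, Finset.nonempty_iff_ne_empty]
        intro h0
        rw [← herase, h0] at hE
        simp [pairCount] at hE
      have hlt : ((A.erase v).card : ℝ) < A.card := by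
        exact_mod_cast Finset.card_erase_lt_of_mem hv
      have h1 := hmax _ (Finset.erase_subset v A)
      rw [herase] at h1
      have h2 := le_of_mul_le_mul_right h1 (by positivity)
      have h3 : (A.card : ℝ) ^ (α - β) < ((A.erase v).card : ℝ) ^ (α - β) :=
        Real.rpow_lt_rpow_of_neg (by exact_mod_cast hpos) hlt (by linarith)
      linarith
  calc (A.card : ℝ) = ∑ _v ∈ A, (1 : ℝ) := by simp
    _ ≤ _ := Finset.sum_le_sum hdeg

/-- Either removing the vertices of degree at least `K` times the average keeps most edges, or
the bipartite graph between them and the rest witnesses linear surplus. -/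
lemma surplus_or_regular_of_maximal [Fintype V] (G : SimpleGraph V) {α β K q : ℝ} (hβ : 0 < β)
    (hαβ : α < β) (hq0 : 0 < q) (hq1 : q < 1) (hK : 0 < K)
    (hKq : K ^ (α - β) = ((1 - q) ^ 2 / 16) ^ β)
    {A : Finset V} (hE : 0 < pairCount G A A)
    (hmax : ∀ S ⊆ A, (S.card : ℝ) ^ (α - β) * pairCount G S S ^ β ≤
      (A.card : ℝ) ^ (α - β) * pairCount G A A ^ β) :
    5 / 128 * (1 - q) ^ 2 * pairCount G A A ≤ surplus G ∨
      ∃ B ⊆ A, q * pairCount G A A ≤ pairCount G B B ∧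
        ∀ v ∈ B, ∑ u ∈ B, adjWeight G v u ≤ K * (pairCount G A A / A.card) := by
  classical
  have hApos : 0 < (A.card : ℝ) := by
    rcases A.eq_empty_or_nonempty with h | h
    · simp [h, pairCount] at hE
    · exact_mod_cast h.card_pos
  set E := pairCount G A A with hEdef
  set P : V → Prop := fun v => K * (E / A.card) < ∑ u ∈ A, adjWeight G v u with hP
  set U := A.filter P with hU
  set B := A.filter fun v => ¬ P v with hB
  have hUA : U ⊆ A := Finset.filter_subset _ _
  have hBA : B ⊆ A := Finset.filter_subset _ _
  by_cases hBE : q * E ≤ pairCount G B B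
  · refine Or.inr ⟨B, hBA, hBE, fun v hv => ?_⟩
    refine le_trans (Finset.sum_le_sum_of_subset_of_nonneg hBA
      fun _ _ _ => adjWeight_nonneg G _ _) (not_lt.1 (Finset.mem_filter.1 hv).2)
  · left
    push Not at hBE
    have hsplit : E = pairCount G U U + 2 * pairCount G U B + pairCount G B B := by
      have e : 2 * pairCount G U B = pairCount G U B + pairCount G B U := by
        rw [pairCount_comm G B U]; ring
      rw [e, hEdef]
      unfold pairCount
      simp only [← Finset.sum_filter_add_sum_filter_not A P, Finset.sum_add_distrib, hU, hB]
      ring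
    have hUcard : (U.card : ℝ) * K ≤ A.card := by
      have h1 : (U.card : ℝ) * (K * (E / A.card)) ≤ E := by
        calc (U.card : ℝ) * (K * (E / A.card)) = ∑ _v ∈ U, K * (E / A.card) := by simp
          _ ≤ ∑ v ∈ U, ∑ u ∈ A, adjWeight G v u :=
              Finset.sum_le_sum fun v hv => (Finset.mem_filter.1 hv).2.le
          _ ≤ E := Finset.sum_le_sum_of_subset_of_nonneg hUA
              fun _ _ _ => Finset.sum_nonneg fun _ _ => adjWeight_nonneg G _ _
      have h2 : (U.card : ℝ) * K / A.card * E ≤ 1 * E := by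
        calc _ = (U.card : ℝ) * (K * (E / A.card)) := by ring
          _ ≤ _ := by linarith
      exact (div_le_one hApos).1 (le_of_mul_le_mul_right h2 hE)
    have hUE : pairCount G U U ≤ (1 - q) ^ 2 / 16 * E := by
      rcases U.eq_empty_or_nonempty with h | h
      · rw [h]
        simp only [pairCount, Finset.sum_empty]
        positivity
      · have hq : 0 < 1 - q := by linarith
        exact le_mul_of_rpow_mul_le hβ hαβ (by exact_mod_cast h.card_pos) hK (by positivity) hKq
          hUcard (pairCount_nonneg G _ _) hE.le (hmax U hUA)
    have hx : ∀ v, |(if v ∈ U then (1 : ℝ) else 0) - (1 - q) / 2 * (if v ∈ B then 1 else 0)| ≤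
        1 := by
      intro v
      by_cases h1 : v ∈ U
      · have h2 : v ∉ B := fun h => (Finset.mem_filter.1 h).2 (Finset.mem_filter.1 h1).2
        simp [h1, h2]
      · by_cases h2 : v ∈ B
        · simp only [h1, h2, if_true, if_false]
          rw [abs_le]; constructor <;> linarith
        · simp [h1, h2]
    have hs := neg_adjForm_le_surplus G _ hx
    rw [adjForm_sub_smul] at hs
    have hUB : (1 - q) * E - (1 - q) ^ 2 / 16 * E ≤ 2 * pairCount G U B := by linarith
    have hqE : (1 - q) ^ 2 * E ≤ (1 - q) * E :=
      mul_le_mul_of_nonneg_right (by nlinarith) hE.le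
    have hUB' : (1 - q) / 2 * (15 / 16 * ((1 - q) * E)) ≤
        (1 - q) / 2 * (2 * pairCount G U B) :=
      mul_le_mul_of_nonneg_left (by linarith) (by linarith)
    have hBB : ((1 - q) / 2) ^ 2 * pairCount G B B ≤ ((1 - q) / 2) ^ 2 * E :=
      mul_le_mul_of_nonneg_left (by nlinarith) (by positivity)
    linarith

/-- Sharper regularization lemma: either `G` has surplus at least `c·n^α·d^β`, or `G`
has an induced subgraph `G̃` with `ñ` vertices, average degree `d̃`,
`ñ^α·d̃^β ≥ (1-ε)·n^α·d^β` and maximum degree at most `C·d̃`. -/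
theorem statement11 (ε α β : ℝ) (hε : 0 < ε) (hβ : 0 < β) (hαβ : α < β)
    (hsum : α + β ≤ 2) :
    ∃ c C : ℝ, 0 < c ∧ 0 < C ∧
      ∀ (V : Type) [Fintype V] (G : SimpleGraph V) (n d : ℝ),
        n = Fintype.card V → 1 ≤ n → d = 2 * edgeCount G / n → 0 < d →
        (surplus G ≥ c * n ^ α * d ^ β ∨
          ∃ A : Finset V, ∀ dt : ℝ,
            dt = 2 * edgeCount (G.induce (↑A : Set V)) / (A.card : ℝ) →
            (A.card : ℝ) ^ α * dt ^ β ≥ (1 - ε) * n ^ α * d ^ β ∧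
            (∀ v ∈ A, (Nat.card {u : V // u ∈ A ∧ G.Adj v u} : ℝ) ≤ C * dt)) := by
  set ε' := min ε (1 / 2) with hε'
  have hε'0 : 0 < ε' := lt_min hε (by norm_num)
  have hε'1 : ε' ≤ 1 / 2 := min_le_right _ _
  have hε'ε : ε' ≤ ε := min_le_left _ _
  set q := (1 - ε') ^ (1 / β) with hq
  have hq0 : 0 < q := Real.rpow_pos_of_pos (by linarith) _
  have hq1 : q < 1 := Real.rpow_lt_one (by linarith) (by linarith) (by positivity)
  have hqβ : q ^ β = 1 - ε' := by
    rw [hq, ← Real.rpow_mul (by linarith), one_div_mul_cancel hβ.ne', Real.rpow_one]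
  have hq' : 0 < 1 - q := by linarith
  have hτ : 0 < (1 - q) ^ 2 / 16 := by positivity
  set K := ((1 - q) ^ 2 / 16) ^ (β / (α - β)) with hKdef
  have hK : 0 < K := Real.rpow_pos_of_pos hτ _
  have hKq : K ^ (α - β) = ((1 - q) ^ 2 / 16) ^ β := by
    rw [hKdef, ← Real.rpow_mul hτ.le, div_mul_cancel₀ _ (by linarith)]
  refine ⟨5 / 128 * (1 - q) ^ 2, K / q, by positivity, by positivity, ?_⟩
  intro V _ G n d hn hn1 hd hd0
  classical
  have hn0 : 0 < n := by linarith
  rw [two_mul_edgeCount] at hd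
  have hE0 : 0 < pairCount G Finset.univ Finset.univ := by
    rw [hd] at hd0; exact (div_pos_iff_of_pos_right hn0).1 hd0
  have hΦ : n ^ α * d ^ β = n ^ (α - β) * pairCount G Finset.univ Finset.univ ^ β := by
    rw [hd]; exact rpow_mul_div_rpow hn0 hE0.le
  obtain ⟨A, -, hA⟩ := Finset.exists_max_image (Finset.univ : Finset (Finset V))
    (fun S => (S.card : ℝ) ^ (α - β) * pairCount G S S ^ β) ⟨∅, Finset.mem_univ _⟩
  have hAV : n ^ α * d ^ β ≤ (A.card : ℝ) ^ (α - β) * pairCount G A A ^ β := by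
    rw [hΦ, hn]
    exact hA Finset.univ (Finset.mem_univ _)
  have hΦ0 : 0 < n ^ α * d ^ β := by positivity
  have hEA : 0 < pairCount G A A := by
    refine lt_of_le_of_ne (pairCount_nonneg G A A) fun h => ?_
    rw [← h, Real.zero_rpow hβ.ne', mul_zero] at hAV
    linarith
  have hmax : ∀ S ⊆ A, (S.card : ℝ) ^ (α - β) * pairCount G S S ^ β ≤
      (A.card : ℝ) ^ (α - β) * pairCount G A A ^ β := fun S _ => hA S (Finset.mem_univ _)
  have card_pos : ∀ S : Finset V, 0 < pairCount G S S → 0 < S.card := by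
    intro S hS
    rw [Finset.card_pos, Finset.nonempty_iff_ne_empty]
    rintro rfl
    simp [pairCount] at hS
  have hApos := card_pos A hEA
  rcases surplus_or_regular_of_maximal G hβ hαβ hq0 hq1 hK hKq hEA hmax with h | h
  · left
    have h1 := rpow_mul_rpow_le_self hαβ hsum (by exact_mod_cast hApos)
      (card_le_pairCount_of_maximal G hαβ hEA hmax) (pairCount_le G A)
    rw [mul_assoc _ (n ^ α)]
    exact (mul_le_mul_of_nonneg_left (hAV.trans h1) (by positivity)).trans h
  · right
    obtain ⟨B, hBA, hBE, hdeg⟩ := h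
    have hEB : 0 < pairCount G B B := lt_of_lt_of_le (by positivity) hBE
    have hBpos : (0 : ℝ) < B.card := by exact_mod_cast card_pos B hEB
    have hBAcard : (B.card : ℝ) ≤ A.card := by exact_mod_cast Finset.card_le_card hBA
    refine ⟨B, fun dt hdt => ?_⟩
    rw [two_mul_edgeCount_induce] at hdt
    subst hdt
    refine ⟨?_, fun v hv => ?_⟩
    · rw [rpow_mul_div_rpow hBpos hEB.le, mul_assoc]
      calc (1 - ε) * (n ^ α * d ^ β) ≤ (1 - ε') * (n ^ α * d ^ β) :=
            mul_le_mul_of_nonneg_right (by linarith) hΦ0.le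
        _ ≤ (1 - ε') * ((A.card : ℝ) ^ (α - β) * pairCount G A A ^ β) :=
            mul_le_mul_of_nonneg_left hAV (by linarith)
        _ = (A.card : ℝ) ^ (α - β) * (q * pairCount G A A) ^ β := by
            rw [Real.mul_rpow hq0.le hEA.le, hqβ]; ring
        _ ≤ (B.card : ℝ) ^ (α - β) * pairCount G B B ^ β :=
            mul_le_mul (Real.rpow_le_rpow_of_nonpos hBpos hBAcard (by linarith))
              (Real.rpow_le_rpow (by positivity) hBE hβ.le) (by positivity) (by positivity)
    · rw [natCard_neighbors]
      calc _ ≤ K * (pairCount G A A / A.card) := hdeg v hv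
        _ = K / q * (q * pairCount G A A / A.card) := by field_simp
        _ ≤ K / q * (pairCount G B B / B.card) := by gcongr

end MaxCutPaper
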